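/- arXiv:2004.14504 — 2 statements merged into one kernel-verified Lean document; each statement's English description precedes it below -/
import Mathlib

section
/- For every Hermitian d×d matrix x and all g₁, g₂ ∈ GL(d,ℂ), the function χ satisfies the multiplicativity relation χ_x(g₂ g₁) = χ_{g₁·x}(g₂) · χ_x(g₁). -/
open Matrix
open scoped ComplexOrder

noncomputable section
open scoped Classical

/-- Square complex matrices of size `d`. -/
abbrev Mat (d : ℕ) := Matrix (Fin d) (Fin d) ℂ

/-- `n` is upper triangular with all diagonal entries equal to `1`. -/
def IsUnitUpperTriangular {d : ℕ} (n : Mat d) : Prop :=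
  n.BlockTriangular (id : Fin d → Fin d) ∧ ∀ i, n i i = 1

/-- `a` is diagonal with positive real diagonal entries. -/
def IsPosDiagonal {d : ℕ} (a : Mat d) : Prop :=
  ∃ f : Fin d → ℝ, (∀ i, 0 < f i) ∧ a = Matrix.diagonal (fun i => (f i : ℂ))

/-- `(k, a, n)` is an Iwasawa (QR) decomposition of `g`: `g = k a n` with `k` unitary,
`a` diagonal with positive real diagonal entries and `n` unit upper triangular. -/
def IsIwasawa {d : ℕ} (g k a n : Mat d) : Prop :=
  g = k * a * n ∧ k ∈ Matrix.unitaryGroup (Fin d) ℂ ∧ IsPosDiagonal a ∧ IsUnitUpperTriangular n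

/-- A choice of the (unique) Iwasawa decomposition `(k(g), a(g), n(g))` of `g`. -/
def iwaTriple {d : ℕ} (g : Mat d) : Mat d × Mat d × Mat d :=
  if h : ∃ t : Mat d × Mat d × Mat d, IsIwasawa g t.1 t.2.1 t.2.2 then h.choose else (1, 1, 1)

/-- The unitary factor `k(g)` in the Iwasawa decomposition of `g`. -/
def iwaK {d : ℕ} (g : Mat d) : Mat d := (iwaTriple g).1

/-- `α(g) = log a(g)`, a real diagonal matrix. -/
def iwaAlpha {d : ℕ} (g : Mat d) : Matrix (Fin d) (Fin d) ℝ :=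
  Matrix.diagonal (fun i => Real.log (((iwaTriple g).2.1 i i).re))

/-- `x = h * diagonal f * h*` with `h` unitary and `f` real and nonincreasing. -/
def IsOrderedDiagonalization {d : ℕ} (x : Mat d) (h : Mat d) (f : Fin d → ℝ) : Prop :=
  h ∈ Matrix.unitaryGroup (Fin d) ℂ ∧ Antitone f ∧
    x = h * Matrix.diagonal (fun i => (f i : ℂ)) * star h

/-- A choice of an ordered spectral decomposition `x = h x₀ h*` of a hermitian matrix. -/
def specPair {d : ℕ} (x : Mat d) : Mat d × (Fin d → ℝ) :=
  if h : ∃ p : Mat d × (Fin d → ℝ), IsOrderedDiagonalization x p.1 p.2 then h.choose else (1, 0)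

/-- `χ_x(g) = exp (2 Tr (x₀ α(g h)))` where `x = h x₀ h*` (independent of the choice of `h`). -/
def chi {d : ℕ} (x g : Mat d) : ℝ :=
  Real.exp (2 * Matrix.trace (Matrix.diagonal (specPair x).2 * iwaAlpha (g * (specPair x).1)))

/-- The extended action of `GL(d, ℂ)` on hermitian matrices: `g · (h x₀ h*) = k(gh) x₀ k(gh)*`. -/
def gAct {d : ℕ} (g x : Mat d) : Mat d :=
  iwaK (g * (specPair x).1) * Matrix.diagonal (fun i => (((specPair x).2 i : ℝ) : ℂ)) *
    star (iwaK (g * (specPair x).1))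

theorem Matrix.BlockTriangular.toSquareBlock_mul {m α R : Type*} [Fintype m] [LinearOrder α]
    [NonUnitalNonAssocSemiring R] {b : m → α} {M N : Matrix m m R} (hM : M.BlockTriangular b)
    (hN : N.BlockTriangular b) (c : α) :
    (M * N).toSquareBlock b c = M.toSquareBlock b c * N.toSquareBlock b c := by
  ext ⟨i, hi⟩ ⟨k, hk⟩
  simp only [toSquareBlock_def, of_apply, mul_apply]
  rw [← Finset.sum_subset (Finset.filter_subset (fun j => b j = c) Finset.univ)]
  · exact Finset.sum_subtype _ (by simp) _
  · intro j _ hj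
    have hj : b j ≠ c := by simpa using hj
    rcases lt_or_gt_of_ne hj with h | h
    · rw [hM (by rwa [hi]), zero_mul]
    · rw [hN (by rwa [hk]), mul_zero]

theorem norm_det_toSquareBlock_of_mem_unitaryGroup {m α : Type*} [Fintype m] [DecidableEq m]
    [LinearOrder α] {b : m → α} {u : Matrix m m ℂ} (hu : u ∈ unitaryGroup m ℂ)
    (hb : u.BlockTriangular b) (c : α) : ‖(u.toSquareBlock b c).det‖ = 1 := by
  have h1 : star u * u = 1 := (mem_unitaryGroup_iff'.1 hu)
  have hs : (star u).BlockTriangular b := by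
    let _ := invertibleOfLeftInverse u _ h1
    rw [← inv_eq_left_inv h1]
    exact blockTriangular_inv_of_blockTriangular hb
  have h2 : (1 : Matrix m m ℂ).toSquareBlock b c = 1 := by
    ext i j
    simp [toSquareBlock_def, one_apply, Subtype.ext_iff]
  have h3 : (star u).toSquareBlock b c = (u.toSquareBlock b c)ᴴ := rfl
  have h4 := congrArg det (hs.toSquareBlock_mul hb c)
  rw [h1, h2, h3, det_mul, det_conjTranspose, det_one] at h4
  have h5 := congrArg norm h4
  rw [norm_mul, norm_star, norm_one] at h5
  nlinarith [norm_nonneg (u.toSquareBlock b c).det]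

theorem norm_det_toSquareBlock_of_upperTriangular {d : ℕ} {α : Type*} [LinearOrder α] {a n : Mat d}
    (ha : IsPosDiagonal a) (hn : IsUnitUpperTriangular n) (b : Fin d → α) (c : α) :
    ‖((a * n).toSquareBlock b c).det‖ = ∏ i with b i = c, (a i i).re := by
  obtain ⟨f, hf, rfl⟩ := ha
  rw [det_of_isUpperTriangular, norm_prod]
  · simp only [toSquareBlock_def, of_apply, diagonal_mul, hn.2, mul_one, diagonal_apply_eq,
      Complex.ofReal_re, Complex.norm_real, Real.norm_of_nonneg (hf _).le]
    exact (Finset.prod_subtype _ (by simp) _).symm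
  · rintro i j hij
    simp only [toSquareBlock_def, of_apply, diagonal_mul]
    rw [hn.1 (by exact hij), mul_zero]

theorem IsIwasawa.blockTriangular {d : ℕ} {g k a n : Mat d} (h : IsIwasawa g k a n)
    {α : Type*} [Preorder α] {b : Fin d → α} (hb : Monotone b) : (a * n).BlockTriangular b := by
  obtain ⟨-, -, ⟨f, hf, rfl⟩, hn⟩ := h
  intro i j hij
  rw [diagonal_mul, hn.1 (show id j < id i from hb.reflect_lt hij), mul_zero]

theorem IsIwasawa.isUnit {d : ℕ} {g k a n : Mat d} (h : IsIwasawa g k a n) :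
    IsUnit (a * n) := by
  obtain ⟨-, -, ⟨f, hf, rfl⟩, hn⟩ := h
  rw [isUnit_iff_isUnit_det, det_mul, det_diagonal, det_of_isUpperTriangular hn.1]
  simp [hn.2, Finset.prod_ne_zero_iff, (hf _).ne']

theorem IsPosDiagonal.re_pos {d : ℕ} {a : Mat d} (ha : IsPosDiagonal a) (i : Fin d) :
    0 < (a i i).re := by
  obtain ⟨f, hf, rfl⟩ := ha
  simpa using hf i

theorem blockTriangular_neg_of_commute {d : ℕ} {m : Mat d} {f : Fin d → ℝ}
    (hm : Commute m (diagonal fun i => (f i : ℂ))) : m.BlockTriangular (fun i => -f i) := by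
  intro i j hij
  have h := congrFun (congrFun hm.eq i) j
  rw [mul_diagonal, diagonal_mul, mul_comm, ← sub_eq_zero, ← sub_mul, mul_eq_zero] at h
  refine h.resolve_left ?_
  rw [sub_eq_zero, Complex.ofReal_inj]
  intro h'
  simp [h'] at hij

/-- The weighted sum of the logarithms of the diagonal factor is invariant under right
multiplication by unitaries commuting with the weight. -/
theorem IsIwasawa.sum_mul_log_eq {d : ℕ} {g k a n k' a' n' m : Mat d} {f : Fin d → ℝ}
    (hf : Antitone f) (h : IsIwasawa g k a n) (h' : IsIwasawa (g * m) k' a' n')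
    (hm : m ∈ unitaryGroup (Fin d) ℂ) (hc : Commute m (diagonal fun i => (f i : ℂ))) :
    ∑ i, f i * Real.log (a i i).re = ∑ i, f i * Real.log (a' i i).re := by
  have hmono : Monotone fun i => -f i := fun i j hij => neg_le_neg (hf hij)
  have hB := h.blockTriangular hmono
  have hB' := h'.blockTriangular hmono
  have hmb := blockTriangular_neg_of_commute hc
  have hk : star k * k = 1 := mem_unitaryGroup_iff'.1 h.2.1
  have hK : star k * k' ∈ unitaryGroup (Fin d) ℂ := mul_mem (Unitary.star_mem h.2.1) h'.2.1
  have heq : a * n * m = star k * k' * (a' * n') := by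
    calc a * n * m = star k * k * (a * n * m) := by rw [hk, one_mul]
      _ = star k * (k * a * n * m) := by simp only [mul_assoc]
      _ = star k * (k' * a' * n') := by rw [← h.1, h'.1]
      _ = _ := by simp only [mul_assoc]
  have hKb : (star k * k').BlockTriangular (fun i => -f i) := by
    let _ := h'.isUnit.invertible
    have : star k * k' = a * n * m * (a' * n')⁻¹ := by
      rw [heq, mul_inv_cancel_right_of_invertible]
    rw [this]
    exact (hB.mul hmb).mul (blockTriangular_inv_of_blockTriangular hB')
  have key (c : ℝ) : ∏ i with -f i = c, (a i i).re = ∏ i with -f i = c, (a' i i).re := by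
    have h1 := congrArg (fun M => ‖(M.toSquareBlock (fun i => -f i) c).det‖) heq
    simp only [(hB.toSquareBlock_mul hmb), hKb.toSquareBlock_mul hB', det_mul, norm_mul,
      norm_det_toSquareBlock_of_mem_unitaryGroup hm hmb,
      norm_det_toSquareBlock_of_mem_unitaryGroup hK hKb,
      norm_det_toSquareBlock_of_upperTriangular h.2.2.1 h.2.2.2,
      norm_det_toSquareBlock_of_upperTriangular h'.2.2.1 h'.2.2.2, one_mul, mul_one] at h1
    exact h1
  have hfib (F : Fin d → ℝ) : ∑ c ∈ Finset.univ.image (fun i => -f i), ∑ i with -f i = c, F i =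
      ∑ i, F i :=
    Finset.sum_fiberwise_of_maps_to (fun i _ => Finset.mem_image_of_mem _ (Finset.mem_univ i)) F
  rw [← hfib, ← hfib fun i => f i * Real.log (a' i i).re]
  refine Finset.sum_congr rfl fun c _ => ?_
  have pull (F : Fin d → ℝ) :
      ∑ i with -f i = c, f i * F i = -c * ∑ i with -f i = c, F i := by
    rw [Finset.mul_sum]
    refine Finset.sum_congr rfl fun i hi => ?_
    rw [← (Finset.mem_filter.1 hi).2, neg_neg]
  rw [pull, pull, ← Real.log_prod fun i _ => (h.2.2.1.re_pos i).ne',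
    ← Real.log_prod fun i _ => (h'.2.2.1.re_pos i).ne', key]

theorem exists_unitary_mul_upperTriangular {d : ℕ} (g : Mat d) :
    ∃ k ∈ unitaryGroup (Fin d) ℂ, ∃ r : Mat d, r.BlockTriangular id ∧ g = k * r := by
  let v : Fin d → EuclideanSpace ℂ (Fin d) := fun j => WithLp.toLp 2 fun i => g i j
  let e := EuclideanSpace.basisFun (Fin d) ℂ
  let b := InnerProductSpace.gramSchmidtOrthonormalBasis (𝕜 := ℂ)
    (finrank_euclideanSpace (𝕜 := ℂ) (ι := Fin d)) v
  refine ⟨e.toBasis.toMatrix b, e.toMatrix_orthonormalBasis_mem_unitary b, b.toBasis.toMatrix v,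
    InnerProductSpace.gramSchmidtOrthonormalBasis_inv_isUpperTriangular _ v, ?_⟩
  have := e.toBasis.toMatrix_mul_toMatrix b.toBasis v
  rw [OrthonormalBasis.coe_toBasis] at this
  rw [this]
  ext i j
  simp [e, v, Module.Basis.toMatrix_apply]

theorem exists_isIwasawa {d : ℕ} {g : Mat d} (hg : IsUnit g) :
    ∃ k a n, IsIwasawa g k a n := by
  obtain ⟨k, hk, r, hr, rfl⟩ := exists_unitary_mul_upperTriangular g
  have hr0 : ∀ i, r i i ≠ 0 := by
    have h := (isUnit_iff_isUnit_det _).1 hg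
    rw [det_mul, det_of_isUpperTriangular hr, isUnit_iff_ne_zero] at h
    simpa [Finset.prod_ne_zero_iff] using right_ne_zero_of_mul h
  have hn0 : ∀ i, (‖r i i‖ : ℂ) ≠ 0 := fun i => by simpa using hr0 i
  refine ⟨k * diagonal fun i => r i i / ‖r i i‖, diagonal fun i => (‖r i i‖ : ℂ),
    (diagonal fun i => (r i i)⁻¹) * r, ?_, mul_mem hk ?_, ⟨_, fun i => norm_pos_iff.2 (hr0 i), rfl⟩,
    fun i j hij => ?_, fun i => ?_⟩
  · simp only [mul_assoc]
    congr 1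
    ext i j
    simp only [diagonal_mul]
    field_simp [hr0 i, hn0 i]
  · rw [mem_unitaryGroup_iff', star_eq_conjTranspose, diagonal_conjTranspose, diagonal_mul_diagonal,
      ← diagonal_one]
    congr 1
    ext i
    have h1 : star (r i i) * r i i = (‖r i i‖ : ℂ) ^ 2 := Complex.conj_mul' _
    simp only [Pi.star_apply, star_div₀]
    rw [div_mul_div_comm, h1, show star (‖r i i‖ : ℂ) = ‖r i i‖ from Complex.conj_ofReal _, sq,
      div_self (mul_ne_zero (hn0 i) (hn0 i))]
  · rw [diagonal_mul, hr hij, mul_zero]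
  · rw [diagonal_mul, inv_mul_cancel₀ (hr0 i)]

theorem isIwasawa_iwaTriple {d : ℕ} {g : Mat d} (hg : IsUnit g) :
    IsIwasawa g (iwaK g) (iwaTriple g).2.1 (iwaTriple g).2.2 := by
  have h : ∃ t : Mat d × Mat d × Mat d, IsIwasawa g t.1 t.2.1 t.2.2 := by
    obtain ⟨k, a, n, h⟩ := exists_isIwasawa hg
    exact ⟨(k, a, n), h⟩
  rw [iwaK, iwaTriple, dif_pos h]
  exact h.choose_spec

/-- Multiplying the diagonal factors: if `g₁ = k₁ a₁ n₁` and `g₂ k₁ = k₂ a₂ n₂`, then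
`g₂ g₁ = k₂ (a₂ a₁) (a₁⁻¹ n₂ a₁ n₁)`. -/
theorem IsIwasawa.mul {d : ℕ} {g₁ g₂ k₁ a₁ n₁ k₂ a₂ n₂ : Mat d} (h₁ : IsIwasawa g₁ k₁ a₁ n₁)
    (h₂ : IsIwasawa (g₂ * k₁) k₂ a₂ n₂) : ∃ n, IsIwasawa (g₂ * g₁) k₂ (a₂ * a₁) n := by
  obtain ⟨rfl, -, ⟨f₁, hf₁, rfl⟩, hn₁⟩ := h₁
  obtain ⟨hg₂, hk₂, ⟨f₂, hf₂, rfl⟩, hn₂⟩ := h₂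
  have hne : ∀ i, (f₁ i : ℂ) ≠ 0 := fun i => Complex.ofReal_ne_zero.2 (hf₁ i).ne'
  have hinv : (diagonal fun i => (f₁ i : ℂ)) * (diagonal fun i => (f₁ i : ℂ)⁻¹) = 1 := by
    simp [diagonal_mul_diagonal, hne]
  have hM : ((diagonal fun i => (f₁ i : ℂ)⁻¹) * n₂ *
      diagonal fun i => (f₁ i : ℂ)).BlockTriangular (id : Fin d → Fin d) :=
    ((blockTriangular_diagonal _).mul hn₂.1).mul (blockTriangular_diagonal _)
  refine ⟨(diagonal fun i => (f₁ i : ℂ)⁻¹) * n₂ * (diagonal fun i => (f₁ i : ℂ)) * n₁, ?_, hk₂,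
    ⟨fun i => f₂ i * f₁ i, fun i => mul_pos (hf₂ i) (hf₁ i), by simp [diagonal_mul_diagonal]⟩,
    hM.mul hn₁.1, fun i => ?_⟩
  · set D := diagonal fun i => (f₁ i : ℂ)
    calc g₂ * (k₁ * D * n₁) = g₂ * k₁ * D * n₁ := by simp only [mul_assoc]
      _ = k₂ * (diagonal fun i => (f₂ i : ℂ)) * 1 * n₂ * D * n₁ := by rw [hg₂, mul_one]
      _ = _ := by rw [← hinv]; simp only [mul_assoc]
  · rw [mul_apply, Finset.sum_eq_single i]
    · rw [hn₁.2, mul_one, mul_diagonal, diagonal_mul, hn₂.2, mul_one, inv_mul_cancel₀ (hne i)]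
    · intro j _ hj
      rcases lt_or_gt_of_ne hj with h | h
      · rw [hM (show id j < id i from h), zero_mul]
      · rw [hn₁.1 (show id i < id j from h), mul_zero]
    · simp

theorem exists_isOrderedDiagonalization {d : ℕ} {x : Mat d} (hx : x.IsHermitian) :
    ∃ h f, IsOrderedDiagonalization x h f := by
  set σ := Tuple.sort (fun i => -hx.eigenvalues i)
  set U : Mat d := (hx.eigenvectorUnitary : Mat d)
  have hU : U ∈ unitaryGroup (Fin d) ℂ := hx.eigenvectorUnitary.2
  refine ⟨U.submatrix id σ, hx.eigenvalues ∘ σ, ?_, ?_, ?_⟩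
  · rw [mem_unitaryGroup_iff, star_eq_conjTranspose, conjTranspose_submatrix, submatrix_mul_equiv,
      submatrix_id_id]
    exact mem_unitaryGroup_iff.1 hU
  · intro i j hij
    exact neg_le_neg_iff.1 (Tuple.monotone_sort (fun i => -hx.eigenvalues i) hij)
  · have hD : (diagonal fun i => ((hx.eigenvalues ∘ σ) i : ℂ)) =
        (diagonal fun i => (hx.eigenvalues i : ℂ)).submatrix σ σ := by
      rw [submatrix_diagonal_equiv]; rfl
    rw [hD, star_eq_conjTranspose, conjTranspose_submatrix, submatrix_mul_equiv,
      submatrix_mul_equiv, submatrix_id_id]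
    exact hx.spectral_theorem

theorem IsOrderedDiagonalization.specPair {d : ℕ} {x h : Mat d} {f : Fin d → ℝ}
    (hx : IsOrderedDiagonalization x h f) :
    IsOrderedDiagonalization x (specPair x).1 (specPair x).2 := by
  have h' : ∃ p : Mat d × (Fin d → ℝ), IsOrderedDiagonalization x p.1 p.2 := ⟨(h, f), hx⟩
  rw [_root_.specPair, dif_pos h']
  exact h'.choose_spec

theorem IsOrderedDiagonalization.roots_charpoly {d : ℕ} {x h : Mat d} {f : Fin d → ℝ}
    (hx : IsOrderedDiagonalization x h f) :
    x.charpoly.roots = (Finset.univ.val.map f).map (fun r : ℝ => (r : ℂ)) := by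
  obtain ⟨hh, -, rfl⟩ := hx
  rw [charpoly_mul_comm, ← mul_assoc, mem_unitaryGroup_iff'.1 hh, one_mul, charpoly_diagonal,
    Polynomial.roots_prod _ _
      (by simp [Finset.prod_ne_zero_iff, Polynomial.X_sub_C_ne_zero])]
  simp [Function.comp_def]

theorem IsOrderedDiagonalization.unique {d : ℕ} {x h h' : Mat d} {f f' : Fin d → ℝ}
    (hx : IsOrderedDiagonalization x h f) (hx' : IsOrderedDiagonalization x h' f') : f = f' := by
  have hm := Multiset.map_injective Complex.ofReal_injective
    (hx.roots_charpoly.symm.trans hx'.roots_charpoly)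
  apply List.ofFn_injective
  refine List.Perm.eq_of_pairwise' hx.2.1.sortedGE_ofFn.pairwise hx'.2.1.sortedGE_ofFn.pairwise ?_
  rw [← Multiset.coe_eq_coe]
  simpa [List.ofFn_eq_map, ← Multiset.map_coe, Fin.univ_def] using hm

theorem IsOrderedDiagonalization.commute {d : ℕ} {x h h' : Mat d} {f : Fin d → ℝ}
    (hx : IsOrderedDiagonalization x h f) (hx' : IsOrderedDiagonalization x h' f) :
    Commute (star h * h') (diagonal fun i => (f i : ℂ)) := by
  set D := diagonal fun i => (f i : ℂ)
  have e : h * D * star h = h' * D * star h' := hx.2.2.symm.trans hx'.2.2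
  have h1 : star h * h = 1 := mem_unitaryGroup_iff'.1 hx.1
  have h2 : star h' * h' = 1 := mem_unitaryGroup_iff'.1 hx'.1
  calc star h * h' * D = star h * (h' * D * star h') * h' := by
        simp only [mul_assoc, h2, mul_one]
    _ = star h * h * D * (star h * h') := by rw [← e]; simp only [mul_assoc]
    _ = D * (star h * h') := by rw [h1, one_mul]

theorem isUnit_of_mem_unitaryGroup {d : ℕ} {h : Mat d} (hh : h ∈ unitaryGroup (Fin d) ℂ) :
    IsUnit h :=
  IsUnit.of_mul_eq_one _ (mem_unitaryGroup_iff.1 hh)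

theorem chi_eq_exp_sum {d : ℕ} {x h g k a n : Mat d} {f : Fin d → ℝ} (hg : IsUnit g)
    (hx : IsOrderedDiagonalization x h f) (hi : IsIwasawa (g * h) k a n) :
    chi x g = Real.exp (2 * ∑ i, f i * Real.log (a i i).re) := by
  have hs := hx.specPair
  have hfs := hx.unique hs
  rw [chi, iwaAlpha, diagonal_mul_diagonal, trace_diagonal, ← hfs]
  rw [← hfs] at hs
  have h1 : h * star h = 1 := mem_unitaryGroup_iff.1 hx.1
  have hu := isIwasawa_iwaTriple (hg.mul (isUnit_of_mem_unitaryGroup hs.1))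
  have he : g * (specPair x).1 = g * h * (star h * (specPair x).1) := by
    rw [mul_assoc g, ← mul_assoc h, h1, one_mul]
  rw [hi.sum_mul_log_eq hx.2.1 (he ▸ hu) (mul_mem (Unitary.star_mem hx.1) hs.1) (hx.commute hs), ← he]

theorem stmt3 (d : ℕ) (hd : 1 ≤ d) (x : Mat d) (hx : x.IsHermitian) (g₁ g₂ : GL (Fin d) ℂ) :
    chi x ((↑g₂ : Mat d) * (↑g₁ : Mat d))
      = chi (gAct (↑g₁ : Mat d) x) (↑g₂ : Mat d) * chi x (↑g₁ : Mat d) := by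
  obtain ⟨h, f, hf⟩ := exists_isOrderedDiagonalization hx
  have hs := hf.specPair
  have h₁ := isIwasawa_iwaTriple (g₁.isUnit.mul (isUnit_of_mem_unitaryGroup hs.1))
  have h₂ := isIwasawa_iwaTriple (g₂.isUnit.mul (isUnit_of_mem_unitaryGroup h₁.2.1))
  have hy : IsOrderedDiagonalization (gAct (g₁ : Mat d) x) (iwaK ((g₁ : Mat d) * (specPair x).1))
      (specPair x).2 := ⟨h₁.2.1, hs.2.1, rfl⟩
  obtain ⟨n, h₃⟩ := h₁.mul h₂
  rw [← mul_assoc] at h₃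
  rw [chi_eq_exp_sum (g₂.isUnit.mul g₁.isUnit) hs h₃, chi_eq_exp_sum g₂.isUnit hy h₂,
    chi_eq_exp_sum g₁.isUnit hs h₁, ← Real.exp_add, ← mul_add, ← Finset.sum_add_distrib]
  have p₁ := h₁.2.2.1.re_pos
  have p₂ := h₂.2.2.1.re_pos
  obtain ⟨f₁, -, e₁⟩ := h₁.2.2.1
  obtain ⟨f₂, -, e₂⟩ := h₂.2.2.1
  rw [e₁] at p₁ ⊢
  rw [e₂] at p₂ ⊢
  congr 2
  refine Finset.sum_congr rfl fun i _ => ?_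
  simp only [diagonal_apply_eq, Complex.ofReal_re] at p₁ p₂
  rw [diagonal_mul_diagonal, diagonal_apply_eq, diagonal_apply_eq, diagonal_apply_eq,
    ← Complex.ofReal_mul, Complex.ofReal_re, Complex.ofReal_re, Complex.ofReal_re,
    Real.log_mul (p₂ i).ne' (p₁ i).ne']
  ring

end
end

section
/- Let ρ be a nonzero positive semidefinite d×d matrix, let x₀ be a real diagonal matrix with nonincreasing diagonal entries, let h be unitary, and set x = h x₀ h*. Then I_ρ(x) = sup over real diagonal matrices α and unit upper triangular matrices n of [ Tr(x₀ α) − ln Tr( n* exp(α/2) h* ρ h exp(α/2) n ) ]. -/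
open Matrix
open scoped ComplexOrder

noncomputable section
open scoped Classical

/-- The rate function `I_ρ(x) = sup_{g ∈ GL(d,ℂ)} (-ln χ_x(g⁻¹) - ln Tr(g* ρ g))`,
with values in `(-∞, ∞]`. -/
def rate {d : ℕ} (ρ x : Mat d) : EReal :=
  ⨆ g : GL (Fin d) ℂ,
    ((- Real.log (chi x (↑g⁻¹ : Mat d))
      - Real.log ((Matrix.trace (star (↑g : Mat d) * ρ * (↑g : Mat d))).re) : ℝ) : EReal)

/-- On block triangular matrices, extracting a diagonal block is multiplicative. -/
lemma toSquareBlock_mul_of_blockTriangular {ι β : Type*} [Fintype ι] [LinearOrder β]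
    {b : ι → β} {M N : Matrix ι ι ℂ} (hM : M.BlockTriangular b) (hN : N.BlockTriangular b)
    (k : β) :
    (M * N).toSquareBlock b k = M.toSquareBlock b k * N.toSquareBlock b k := by
  ext ⟨i, hi⟩ ⟨j, hj⟩
  simp only [toSquareBlock_def, of_apply, mul_apply]
  rw [← Finset.sum_subtype (Finset.univ.filter fun l => b l = k) (by simp)
    (fun l => M i l * N l j)]
  symm
  apply Finset.sum_filter_of_ne
  intro l _ hl
  by_contra hlk
  rcases lt_or_gt_of_ne hlk with h | h
  · exact hl (by rw [hM (hi.symm ▸ h), zero_mul])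
  · exact hl (by rw [hN (hj.symm ▸ h), mul_zero])

/-- The diagonal blocks of a block triangular unitary matrix have determinant of modulus one. -/
lemma norm_det_toSquareBlock_of_unitary {ι β : Type*} [Fintype ι] [DecidableEq ι] [LinearOrder β]
    {b : ι → β} {U : Matrix ι ι ℂ} (hU : U ∈ Matrix.unitaryGroup ι ℂ)
    (hb : U.BlockTriangular b) (k : β) : ‖(U.toSquareBlock b k).det‖ = 1 := by
  have hmul : star U * U = 1 := (Matrix.mem_unitaryGroup_iff').1 hU
  have hmul' : U * star U = 1 := (Matrix.mem_unitaryGroup_iff).1 hU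
  let _ : Invertible U := ⟨star U, hmul, hmul'⟩
  have hs : (star U).BlockTriangular b := by
    have := blockTriangular_inv_of_blockTriangular hb
    rwa [Matrix.inv_eq_right_inv hmul'] at this
  have h1 := toSquareBlock_mul_of_blockTriangular hb hs k
  have h2 : (star U).toSquareBlock b k = (U.toSquareBlock b k)ᴴ := rfl
  have h3 : (1 : Matrix ι ι ℂ).toSquareBlock b k = 1 := by
    ext i j
    simp [toSquareBlock_def, one_apply, Subtype.ext_iff]
  rw [hmul', h2, h3] at h1
  have h4 := congrArg (fun M => ‖M.det‖) h1
  simp only [det_one, norm_one, det_mul, det_conjTranspose, norm_mul, norm_star] at h4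
  nlinarith [norm_nonneg (U.toSquareBlock b k).det]

lemma det_toSquareBlock_of_upperTriangular {d : ℕ} {β : Type*} [LinearOrder β] (b : Fin d → β)
    {M : Mat d} (hM : M.BlockTriangular (id : Fin d → Fin d)) (k : β) :
    (M.toSquareBlock b k).det = ∏ i : {i // b i = k}, M i i := by
  have : (M.toSquareBlock b k).IsUpperTriangular := fun i j hij => hM hij
  rw [det_of_isUpperTriangular this]
  rfl

namespace IsUnitUpperTriangular

variable {d : ℕ} {n : Mat d}

lemma det_eq_one (hn : IsUnitUpperTriangular n) : n.det = 1 := by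
  have : n.IsUpperTriangular := hn.1
  rw [det_of_isUpperTriangular this]
  simp [hn.2]

lemma isUnit_det (hn : IsUnitUpperTriangular n) : IsUnit n.det := by
  simp [hn.det_eq_one]

lemma inv (hn : IsUnitUpperTriangular n) : IsUnitUpperTriangular n⁻¹ := by
  let _ : Invertible n := invertibleOfIsUnitDet n hn.isUnit_det
  have hi : (n⁻¹).BlockTriangular (id : Fin d → Fin d) :=
    blockTriangular_inv_of_blockTriangular hn.1
  refine ⟨hi, fun i => ?_⟩
  have h1 := congrFun (congrFun (n.mul_nonsing_inv hn.isUnit_det) i) i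
  rw [mul_apply, Finset.sum_eq_single i, hn.2, one_mul] at h1
  · simpa using h1
  · intro j _ hj
    rcases lt_or_gt_of_ne hj with h | h
    · rw [hn.1 h, zero_mul]
    · rw [hi h, mul_zero]
  · simp

lemma diagonal_conj (hn : IsUnitUpperTriangular n) {u v : Fin d → ℂ} (huv : ∀ i, u i * v i = 1) :
    IsUnitUpperTriangular (Matrix.diagonal u * n * Matrix.diagonal v) := by
  refine ⟨((blockTriangular_diagonal u).mul hn.1).mul (blockTriangular_diagonal v), fun i => ?_⟩
  rw [mul_diagonal, diagonal_mul, hn.2, mul_one, huv]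

end IsUnitUpperTriangular

/-- Existence of the Iwasawa decomposition, by Gram-Schmidt orthogonalisation of the columns. -/
lemma exists_isIwasawa_s8 {d : ℕ} {g : Mat d} (hg : IsUnit g.det) :
    ∃ t : Mat d × Mat d × Mat d, IsIwasawa g t.1 t.2.1 t.2.2 := by
  let v : Fin d → EuclideanSpace ℂ (Fin d) := fun j => WithLp.toLp 2 (fun i => g i j)
  have hv : LinearIndependent ℂ v := by
    have h1 : LinearIndependent ℂ g.col :=
      linearIndependent_cols_of_isUnit ((isUnit_iff_isUnit_det g).2 hg)
    exact h1.map' (WithLp.linearEquiv 2 ℂ (Fin d → ℂ)).symm.toLinearMap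
      (LinearEquiv.ker _)
  let w := InnerProductSpace.gramSchmidt ℂ v
  have hw : ∀ j, w j ≠ 0 := fun j => InnerProductSpace.gramSchmidt_ne_zero j hv
  have hw' : ∀ j, (‖w j‖ : ℂ) ≠ 0 := fun j => by simpa using hw j
  let c : Fin d → Fin d → ℂ := fun i j => inner ℂ (w i) (v j) / (‖w i‖ : ℂ) ^ 2
  let n : Mat d := fun i j => if i = j then 1 else if i < j then c i j else 0
  let k : Mat d := Matrix.of fun i j => w j i / ‖w j‖
  refine ⟨(k, Matrix.diagonal (fun j => ((‖w j‖ : ℝ) : ℂ)), n),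
    ?_, ?_, ⟨fun j => ‖w j‖, fun j => norm_pos_iff.2 (hw j), rfl⟩, ?_, ?_⟩
  · ext i j
    have h1 := congrArg (fun x : EuclideanSpace ℂ (Fin d) => x i)
      (InnerProductSpace.gramSchmidt_def'' ℂ v j)
    simp only [PiLp.add_apply, WithLp.ofLp_sum, Finset.sum_apply, PiLp.smul_apply,
      smul_eq_mul] at h1
    have h2 : ∀ l, w l i / (‖w l‖ : ℂ) * (‖w l‖ : ℂ) * n l j
        = (if l = j then w l i else 0) + if l ∈ Finset.Iio j then c l j * w l i else 0 := by
      intro l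
      rw [div_mul_cancel₀ _ (hw' l)]
      by_cases hlj : l = j
      · subst hlj; simp [n]
      · by_cases hlt : l < j
        · simp [n, hlj, hlt, mul_comm]
        · simp [n, hlj, hlt]
    change g i j = (k * Matrix.diagonal (fun j => ((‖w j‖ : ℝ) : ℂ)) * n) i j
    rw [mul_apply]
    simp only [mul_diagonal, k, of_apply]
    rw [Finset.sum_congr rfl fun l _ => h2 l, Finset.sum_add_distrib, Finset.sum_ite_eq' ,
      Finset.sum_ite_mem]
    simpa using h1
  · rw [Matrix.mem_unitaryGroup_iff']
    ext i j
    have h1 : inner ℂ (w i) (w j) = ∑ l, star (w i l) * w j l := by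
      simp [PiLp.inner_apply, mul_comm]
    have h2 : (star k * k) i j = inner ℂ (w i) (w j) / (‖w i‖ * ‖w j‖) := by
      rw [h1, mul_apply, Finset.sum_div]
      refine Finset.sum_congr rfl fun l _ => ?_
      simp [k, star_apply, div_mul_div_comm]
    refine h2.trans ?_
    by_cases hij : i = j
    · subst hij
      rw [inner_self_eq_norm_sq_to_K, one_apply_eq]
      have := hw' i
      simp only [Complex.coe_algebraMap]
      field_simp
    · rw [one_apply_ne hij, InnerProductSpace.gramSchmidt_orthogonal ℂ v hij, zero_div]
  · intro i j hij
    have hij' : j < i := hij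
    simp [n, hij'.ne', hij'.le]
  · intro i
    simp [n]

lemma IsPosDiagonal.isUnit_det {d : ℕ} {a : Mat d} (ha : IsPosDiagonal a) : IsUnit a.det := by
  obtain ⟨u, hu, rfl⟩ := ha
  rw [det_diagonal, isUnit_iff_ne_zero]
  exact Finset.prod_ne_zero_iff.2 fun i _ => by exact_mod_cast (hu i).ne'

lemma isUnit_det_of_unitary {d : ℕ} {k : Mat d} (hk : k ∈ Matrix.unitaryGroup (Fin d) ℂ) :
    IsUnit k.det :=
  (isUnit_iff_isUnit_det k).1 (isUnit_iff_exists.2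
    ⟨star k, Matrix.mem_unitaryGroup_iff.1 hk, Matrix.mem_unitaryGroup_iff'.1 hk⟩)

lemma IsIwasawa.isUnit_det {d : ℕ} {g k a n : Mat d} (hg : IsIwasawa g k a n) :
    IsUnit g.det := by
  obtain ⟨rfl, hk, ha, hn⟩ := hg
  rw [det_mul, det_mul]
  exact ((isUnit_det_of_unitary hk).mul ha.isUnit_det).mul hn.isUnit_det

/-- Two antitone diagonals which are unitarily equivalent agree. -/
lemma antitone_eq_of_unitary_intertwine {d : ℕ} {f f' : Fin d → ℝ} (hf : Antitone f)
    (hf' : Antitone f') {U : Mat d} (hU : IsUnit U.det)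
    (h : ∀ i j, U i j * f' j = f i * U i j) : f' = f := by
  have hne : U.det ≠ 0 := hU.ne_zero
  rw [det_apply] at hne
  obtain ⟨σ, -, hσ⟩ := Finset.exists_ne_zero_of_sum_ne_zero hne
  have hσ' : ∏ i, U (σ i) i ≠ 0 := fun h0 => hσ (by rw [h0, smul_zero])
  rw [Finset.prod_ne_zero_iff] at hσ'
  have key : f' = f ∘ σ := by
    funext i
    have h1 := h (σ i) i
    rw [mul_comm] at h1
    exact_mod_cast mul_right_cancel₀ (hσ' i (Finset.mem_univ i)) h1
  have := Tuple.unique_monotone (f := fun i => OrderDual.toDual (f i)) (σ := σ) (τ := 1)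
    (fun i j hij => by simpa [key] using hf' hij) (fun i j hij => hf hij)
  rw [key]
  funext i
  exact congrFun this i

/-- The pairing of the spectrum of `x` with the logarithm of the Iwasawa diagonal part does not
depend on the ordered diagonalization of `x`, nor on the decomposition. -/
lemma sum_mul_log_iwasawa_eq {d : ℕ} {x g h h' k k' a a' n n' : Mat d} {f f' : Fin d → ℝ}
    (hx : IsOrderedDiagonalization x h f) (hx' : IsOrderedDiagonalization x h' f')
    (hg : IsIwasawa (g * h) k a n) (hg' : IsIwasawa (g * h') k' a' n') :
    ∑ i, f' i * Real.log (a' i i).re = ∑ i, f i * Real.log (a i i).re := by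
  obtain ⟨hh, hf, rfl⟩ := hx
  obtain ⟨hh', hf', hx'⟩ := hx'
  have hU : star h * h' ∈ Matrix.unitaryGroup (Fin d) ℂ := mul_mem (Unitary.star_mem hh) hh'
  have hcomm : star h * h' * Matrix.diagonal (fun i => (f' i : ℂ))
      = Matrix.diagonal (fun i => (f i : ℂ)) * (star h * h') := by
    have h1 := congrArg (fun M => star h * M * h') hx'
    have e1 : star h * h = 1 := Matrix.mem_unitaryGroup_iff'.1 hh
    have e2 : star h' * h' = 1 := Matrix.mem_unitaryGroup_iff'.1 hh'
    calc _ = star h * (h' * Matrix.diagonal (fun i => (f' i : ℂ)) * star h') * h' := by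
          simp only [Matrix.mul_assoc, e2, Matrix.mul_one]
      _ = (star h * h) * Matrix.diagonal (fun i => (f i : ℂ)) * (star h * h') := by
          rw [← hx']; simp only [Matrix.mul_assoc]
      _ = _ := by rw [e1, Matrix.one_mul]
  have hgU : g * h * (star h * h') = g * h' := by
    rw [← Matrix.mul_assoc, Matrix.mul_assoc g, Matrix.mem_unitaryGroup_iff.1 hh, Matrix.mul_one]
  generalize star h * h' = U at hU hcomm hgU
  have hent : ∀ i j, U i j * f' j = f i * U i j := fun i j => by
    simpa [mul_diagonal, diagonal_mul] using congrFun (congrFun hcomm i) j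
  obtain rfl := antitone_eq_of_unitary_intertwine hf hf' (isUnit_det_of_unitary hU) hent
  let b : Fin d → ℝᵒᵈ := fun i => OrderDual.toDual (f' i)
  have hbU : U.BlockTriangular b := by
    intro i j hij
    have hne : (f' j : ℂ) ≠ f' i := by
      have : f' i < f' j := hij
      exact_mod_cast this.ne'
    by_contra h0
    have := hent i j
    rw [mul_comm] at this
    exact hne (mul_right_cancel₀ h0 this)
  have hup : ∀ M : Mat d, M.BlockTriangular (id : Fin d → Fin d) → M.BlockTriangular b := by
    intro M hM i j hij
    refine hM ?_
    by_contra hle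
    exact absurd (hf (not_lt.1 hle)) (not_le.2 hij)
  obtain ⟨e, hk, ⟨u, hu, rfl⟩, hn⟩ := hg
  obtain ⟨e', hk', ⟨u', hu', rfl⟩, hn'⟩ := hg'
  set A := Matrix.diagonal (fun i => (u i : ℂ)) * n with hA
  set A' := Matrix.diagonal (fun i => (u' i : ℂ)) * n' with hA'
  have hAt : A.BlockTriangular (id : Fin d → Fin d) := (blockTriangular_diagonal _).mul hn.1
  have hAt' : A'.BlockTriangular (id : Fin d → Fin d) := (blockTriangular_diagonal _).mul hn'.1
  have hAd : ∀ i, A i i = u i := fun i => by rw [hA, diagonal_mul, hn.2, mul_one]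
  have hAd' : ∀ i, A' i i = u' i := fun i => by rw [hA', diagonal_mul, hn'.2, mul_one]
  have hAu : IsUnit A'.det := by
    rw [hA', det_mul]
    exact (IsPosDiagonal.isUnit_det ⟨u', hu', rfl⟩).mul hn'.isUnit_det
  have hQ : star k * k' ∈ Matrix.unitaryGroup (Fin d) ℂ := mul_mem (Unitary.star_mem hk) hk'
  have hAQ : A * U = star k * k' * A' := by
    rw [e, e', Matrix.mul_assoc k, Matrix.mul_assoc k', ← hA, ← hA'] at hgU
    rw [Matrix.mul_assoc (star k), ← hgU, ← Matrix.mul_assoc, ← Matrix.mul_assoc,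
      Matrix.mem_unitaryGroup_iff'.1 hk, Matrix.one_mul]
  generalize star k * k' = Q at hQ hAQ
  have hbQ : Q.BlockTriangular b := by
    have hQe : Q = A * U * A'⁻¹ := by
      rw [hAQ, Matrix.mul_assoc, A'.mul_nonsing_inv hAu, Matrix.mul_one]
    let _ : Invertible A' := invertibleOfIsUnitDet A' hAu
    rw [hQe]
    exact ((hup _ hAt).mul hbU).mul (hup _ (blockTriangular_inv_of_blockTriangular hAt'))
  have hprod : ∀ c, ∏ i : {i // b i = c}, u i = ∏ i : {i // b i = c}, u' i := by
    intro c
    have h1 := congrArg (fun M : Mat d => ‖(M.toSquareBlock b c).det‖) hAQ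
    simp only [toSquareBlock_mul_of_blockTriangular (hup _ hAt) hbU,
      toSquareBlock_mul_of_blockTriangular hbQ (hup _ hAt'), det_mul, norm_mul,
      norm_det_toSquareBlock_of_unitary hU hbU, norm_det_toSquareBlock_of_unitary hQ hbQ,
      det_toSquareBlock_of_upperTriangular b hAt, det_toSquareBlock_of_upperTriangular b hAt',
      hAd, hAd', norm_prod, Complex.norm_real, Real.norm_eq_abs, abs_of_pos (hu _),
      abs_of_pos (hu' _), one_mul, mul_one] at h1
    exact h1
  simp only [diagonal_apply_eq, Complex.ofReal_re]
  have hlog : ∀ u : Fin d → ℝ, (∀ i, 0 < u i) → ∑ i, f' i * Real.log (u i)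
      = ∑ c ∈ Finset.univ.image b,
          OrderDual.ofDual c * Real.log (∏ i : {i // b i = c}, u i) := by
    intro u hu
    rw [← Finset.sum_fiberwise_of_maps_to (g := b) (t := Finset.univ.image b)
      (fun i hi => Finset.mem_image_of_mem b hi)]
    refine Finset.sum_congr rfl fun c _ => ?_
    rw [Real.log_prod fun i _ => (hu _).ne', Finset.mul_sum,
      ← Finset.sum_subtype (Finset.univ.filter fun l => b l = c) (by simp)
        (fun i => OrderDual.ofDual c * Real.log (u i))]
    refine Finset.sum_congr rfl fun i hi => ?_
    rw [← (Finset.mem_filter.1 hi).2]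
    rfl
  rw [hlog u hu, hlog u' hu']
  simp only [hprod]

/-- `χ_x` may be computed from any ordered diagonalization and any Iwasawa decomposition. -/
lemma log_chi_eq {d : ℕ} {x g h k a n : Mat d} {f : Fin d → ℝ}
    (hx : IsOrderedDiagonalization x h f) (hg : IsIwasawa (g * h) k a n) :
    Real.log (chi x g) = 2 * ∑ i, f i * Real.log (a i i).re := by
  have hex : ∃ p : Mat d × (Fin d → ℝ), IsOrderedDiagonalization x p.1 p.2 := ⟨(h, f), hx⟩
  have hspec : IsOrderedDiagonalization x (specPair x).1 (specPair x).2 := by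
    rw [specPair, dif_pos hex]
    exact hex.choose_spec
  have hdet : IsUnit (g * (specPair x).1).det := by
    have h1 := hg.isUnit_det
    rw [det_mul] at h1 ⊢
    exact (isUnit_of_mul_isUnit_left h1).mul (isUnit_det_of_unitary hspec.1)
  have hiwa : IsIwasawa (g * (specPair x).1) (iwaTriple (g * (specPair x).1)).1
      (iwaTriple (g * (specPair x).1)).2.1 (iwaTriple (g * (specPair x).1)).2.2 := by
    rw [iwaTriple, dif_pos (exists_isIwasawa_s8 hdet)]
    exact (exists_isIwasawa_s8 hdet).choose_spec
  rw [chi, Real.log_exp, iwaAlpha, diagonal_mul_diagonal, trace_diagonal,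
    sum_mul_log_iwasawa_eq hx hspec hg hiwa]

/-- Unitary invariance of `Tr (g* ρ g)` in the factorization `g = h b k`. -/
lemma trace_star_mul_mul_eq {d : ℕ} (ρ h b : Mat d) {k : Mat d}
    (hk : k ∈ Matrix.unitaryGroup (Fin d) ℂ) :
    Matrix.trace (star (h * b * k) * ρ * (h * b * k))
      = Matrix.trace (star b * (star h * ρ * h) * b) := by
  rw [star_mul, star_mul]
  have : star k * (star b * star h) * ρ * (h * b * k)
      = star k * (star b * (star h * ρ * h) * b * k) := by
    simp only [Matrix.mul_assoc]
  rw [this, trace_mul_comm, Matrix.mul_assoc, Matrix.mem_unitaryGroup_iff.1 hk, Matrix.mul_one]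

lemma star_diagonal_ofReal {d : ℕ} (u : Fin d → ℝ) :
    star (Matrix.diagonal (fun i => (u i : ℂ))) = Matrix.diagonal (fun i => (u i : ℂ)) := by
  rw [star_eq_conjTranspose, diagonal_conjTranspose]
  congr 1
  funext i
  exact Complex.conj_ofReal (u i)

theorem stmt8 (d : ℕ) (hd : 1 ≤ d) (ρ : Mat d) (hρ : ρ.PosSemidef) (hρ0 : ρ ≠ 0)
    (f : Fin d → ℝ) (hf : Antitone f) (h : Mat d) (hh : h ∈ Matrix.unitaryGroup (Fin d) ℂ) :
    rate ρ (h * Matrix.diagonal (fun i => (f i : ℂ)) * star h)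
      = ⨆ (a : Fin d → ℝ) (n : {n : Mat d // IsUnitUpperTriangular n}),
          (((∑ i, f i * a i)
            - Real.log ((Matrix.trace (star (↑n : Mat d)
                * Matrix.diagonal (fun i => ((Real.exp (a i / 2) : ℝ) : ℂ))
                * (star h * ρ * h)
                * Matrix.diagonal (fun i => ((Real.exp (a i / 2) : ℝ) : ℂ))
                * (↑n : Mat d))).re) : ℝ) : EReal) := by
  set x : Mat d := h * Matrix.diagonal (fun i => (f i : ℂ)) * star h with hx
  have hxd : IsOrderedDiagonalization x h f := ⟨hh, hf, hx⟩
  have hhs : star h * h = 1 := Matrix.mem_unitaryGroup_iff'.1 hh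
  have hhs' : h * star h = 1 := Matrix.mem_unitaryGroup_iff.1 hh
  refine le_antisymm (iSup_le fun g => ?_) (iSup₂_le fun a n => ?_)
  · have hdet : IsUnit ((↑g⁻¹ : Mat d) * h).det := by
      rw [det_mul]
      exact ((isUnit_iff_isUnit_det _).1 g⁻¹.isUnit).mul (isUnit_det_of_unitary hh)
    obtain ⟨⟨k, a, n⟩, hI⟩ := exists_isIwasawa_s8 hdet
    rw [log_chi_eq hxd hI]
    obtain ⟨e, hk, ⟨u, hu, rfl⟩, hn⟩ := hI
    simp only at e hk hn
    set α : Fin d → ℝ := fun i => -2 * Real.log (u i) with hα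
    have hexp : ∀ i, Real.exp (α i / 2) = (u i)⁻¹ := fun i => by
      rw [hα, show -2 * Real.log (u i) / 2 = -Real.log (u i) by ring, Real.exp_neg,
        Real.exp_log (hu i)]
    have huv : ∀ i, (u i : ℂ) * ((Real.exp (α i / 2) : ℝ) : ℂ) = 1 := fun i => by
      rw [hexp]
      exact_mod_cast mul_inv_cancel₀ (hu i).ne'
    set D := Matrix.diagonal (fun i => ((Real.exp (α i / 2) : ℝ) : ℂ)) with hD
    have hDs : star D = D := star_diagonal_ofReal _
    set E := Matrix.diagonal (fun i => (u i : ℂ)) with hE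
    have hED : E * D = 1 := by
      rw [hE, hD, diagonal_mul_diagonal]
      simp only [huv, diagonal_one]
    have hDE : D * E = 1 := mul_eq_one_comm.1 hED
    have hgeq : (↑g : Mat d) = h * (D * (E * n⁻¹ * D)) * star k := by
      have h1 : (↑g⁻¹ : Mat d) * (h * (D * (E * n⁻¹ * D)) * star k) = 1 := by
        calc _ = ((↑g⁻¹ : Mat d) * h) * (D * E) * n⁻¹ * D * star k := by simp only [Matrix.mul_assoc]
          _ = k * (E * (n * n⁻¹) * D) * star k := by
            rw [e, hDE, Matrix.mul_one]; simp only [Matrix.mul_assoc]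
          _ = 1 := by
            rw [n.mul_nonsing_inv hn.isUnit_det, Matrix.mul_one, hED, Matrix.mul_one,
              Matrix.mem_unitaryGroup_iff.1 hk]
      have h2 : (↑g : Mat d) * (↑g⁻¹ : Mat d) = 1 := Units.mul_inv g
      calc (↑g : Mat d) = ↑g * ((↑g⁻¹ : Mat d) * (h * (D * (E * n⁻¹ * D)) * star k)) := by
            rw [h1, Matrix.mul_one]
        _ = _ := by rw [← Matrix.mul_assoc, h2, Matrix.one_mul]
    refine le_iSup₂_of_le α ⟨E * n⁻¹ * D, hn.inv.diagonal_conj huv⟩ (le_of_eq ?_)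
    congr 1
    congr 1
    · simp only [hE, diagonal_apply_eq, Complex.ofReal_re, hα, Finset.mul_sum,
        ← Finset.sum_neg_distrib]
      exact Finset.sum_congr rfl fun i _ => by ring
    · rw [hgeq, trace_star_mul_mul_eq _ _ _ (Unitary.star_mem hk), star_mul D, hDs]
      simp only [Matrix.mul_assoc, hD]
  · obtain ⟨n, hn⟩ := n
    set D := Matrix.diagonal (fun i => ((Real.exp (a i / 2) : ℝ) : ℂ)) with hD
    have hDs : star D = D := star_diagonal_ofReal _
    set E := Matrix.diagonal (fun i => ((Real.exp (-(a i / 2)) : ℝ) : ℂ)) with hE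
    have hvu : ∀ i, ((Real.exp (a i / 2) : ℝ) : ℂ) * ((Real.exp (-(a i / 2)) : ℝ) : ℂ) = 1 :=
      fun i => by rw [← Complex.ofReal_mul, ← Real.exp_add, add_neg_cancel, Real.exp_zero,
        Complex.ofReal_one]
    have hDE : D * E = 1 := by
      rw [hE, hD, diagonal_mul_diagonal]
      simp only [hvu, diagonal_one]
    have hED : E * D = 1 := mul_eq_one_comm.1 hDE
    have hnn : n * n⁻¹ = 1 := n.mul_nonsing_inv hn.isUnit_det
    have hmul : (h * (D * n)) * (n⁻¹ * E * star h) = 1 := by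
      calc _ = h * (D * (n * n⁻¹) * E) * star h := by simp only [Matrix.mul_assoc]
        _ = 1 := by rw [hnn, Matrix.mul_one, hDE, Matrix.mul_one, hhs']
    let g : GL (Fin d) ℂ := ⟨h * (D * n), n⁻¹ * E * star h, hmul, mul_eq_one_comm.1 hmul⟩
    have hI : IsIwasawa ((↑g⁻¹ : Mat d) * h) 1 E (D * n⁻¹ * E) := by
      refine ⟨?_, one_mem _, ⟨fun i => Real.exp (-(a i / 2)), fun i => Real.exp_pos _, rfl⟩,
        hn.inv.diagonal_conj hvu⟩
      change n⁻¹ * E * star h * h = _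
      rw [Matrix.mul_assoc, hhs, Matrix.mul_one, Matrix.one_mul, ← Matrix.mul_assoc,
        ← Matrix.mul_assoc, hED, Matrix.one_mul]
    refine le_iSup_of_le g (le_of_eq ?_)
    rw [log_chi_eq hxd hI]
    congr 1
    congr 1
    · simp only [hE, diagonal_apply_eq, Complex.ofReal_re, Real.log_exp, Finset.mul_sum,
        ← Finset.sum_neg_distrib]
      exact Finset.sum_congr rfl fun i _ => by ring
    · have h1 := trace_star_mul_mul_eq ρ h (D * n) (one_mem (Matrix.unitaryGroup (Fin d) ℂ))
      rw [Matrix.mul_one] at h1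
      change _ = Real.log (Matrix.trace (star (h * (D * n)) * ρ * (h * (D * n)))).re
      rw [h1, star_mul D, hDs]
      simp only [Matrix.mul_assoc]

end
end
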